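/- arXiv:1303.0854 — 3 statements merged into one kernel-verified Lean document; each statement's English description precedes it below -/
import Mathlib

section
/- For all a,b,c,d ∈ ℕ ∪ {∅} (in particular for all a,b,c,d ∈ ℕ) and all n ≥ 1, Q_{n,132}^{(a,b,c,d)}(x) = Q_{n,132}^{(a,d,c,b)}(x). Equivalently, the map σ ↦ σ^{-1} on 132-avoiding permutations of {1,…,n} satisfies mmp^{(a,b,c,d)}(σ^{-1}) = mmp^{(a,d,c,b)}(σ), so the two statistics mmp^{(a,b,c,d)} and mmp^{(a,d,c,b)} are equidistributed on S_n(132). -/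
open Finset Polynomial

/-- `σ i` matches the quadrant marked mesh pattern `MMP(a,b,c,d)` in `σ`:
there are at least `a` indices `j > i` with `σ j > σ i`, at least `b` indices
`j < i` with `σ j > σ i`, at least `c` indices `j < i` with `σ j < σ i`, and
at least `d` indices `j > i` with `σ j < σ i`. -/
def MatchesMMP {n : ℕ} (a b c d : ℕ) (σ : Equiv.Perm (Fin n)) (i : Fin n) : Prop :=
  a ≤ (Finset.univ.filter (fun j => i < j ∧ σ i < σ j)).card ∧
  b ≤ (Finset.univ.filter (fun j => j < i ∧ σ i < σ j)).card ∧
  c ≤ (Finset.univ.filter (fun j => j < i ∧ σ j < σ i)).card ∧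
  d ≤ (Finset.univ.filter (fun j => i < j ∧ σ j < σ i)).card

instance {n : ℕ} (a b c d : ℕ) (σ : Equiv.Perm (Fin n)) :
    DecidablePred (MatchesMMP a b c d σ) := fun i => by
  unfold MatchesMMP; infer_instance

/-- `mmp a b c d σ` is the number of indices `i` such that `σ i` matches
`MMP(a,b,c,d)` in `σ`. -/
def mmp {n : ℕ} (a b c d : ℕ) (σ : Equiv.Perm (Fin n)) : ℕ :=
  (Finset.univ.filter (MatchesMMP a b c d σ)).card

/-- `σ` avoids the classical pattern 132. -/
def Avoids132 {n : ℕ} (σ : Equiv.Perm (Fin n)) : Prop :=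
  ¬ ∃ i j k : Fin n, i < j ∧ j < k ∧ σ i < σ k ∧ σ k < σ j

instance {n : ℕ} : DecidablePred (Avoids132 (n := n)) := fun σ => by
  unfold Avoids132; infer_instance

/-- The set `S_n(132)` of 132-avoiding permutations of `{1,…,n}`. -/
def Av132 (n : ℕ) : Finset (Equiv.Perm (Fin n)) :=
  Finset.univ.filter Avoids132

/-- `Q n a b c d = Σ_{σ ∈ S_n(132)} x^{mmp^{(a,b,c,d)}(σ)}`, a polynomial in `ℤ[x]`. -/
noncomputable def Q (n a b c d : ℕ) : Polynomial ℤ :=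
  ∑ σ ∈ Av132 n, Polynomial.X ^ (mmp a b c d σ)

theorem card_filter_inv {n : ℕ} (σ : Equiv.Perm (Fin n)) (p q : Fin n → Prop)
    [DecidablePred p] [DecidablePred q] (h : ∀ j, q j ↔ p (σ j)) :
    (Finset.univ.filter p).card = (Finset.univ.filter q).card := by
  symm
  refine Finset.card_bij (fun j _ => σ j) ?_ ?_ ?_
  · intro j hj
    simpa [h] using hj
  · intro x _ y _ hxy
    exact σ.injective hxy
  · intro y hy
    refine ⟨σ⁻¹ y, ?_, by simp⟩
    simpa [h] using hy

theorem matches_inv {n : ℕ} (a b c d : ℕ) (σ : Equiv.Perm (Fin n)) (i : Fin n) :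
    MatchesMMP a d c b σ i ↔ MatchesMMP a b c d σ⁻¹ (σ i) := by
  unfold MatchesMMP
  rw [card_filter_inv σ (fun j => σ i < j ∧ σ⁻¹ (σ i) < σ⁻¹ j)
      (fun j => i < j ∧ σ i < σ j) (by intro j; simp [and_comm]),
    card_filter_inv σ (fun j => j < σ i ∧ σ⁻¹ (σ i) < σ⁻¹ j)
      (fun j => i < j ∧ σ j < σ i) (by intro j; simp [and_comm]),
    card_filter_inv σ (fun j => j < σ i ∧ σ⁻¹ j < σ⁻¹ (σ i))
      (fun j => j < i ∧ σ j < σ i) (by intro j; simp [and_comm]),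
    card_filter_inv σ (fun j => σ i < j ∧ σ⁻¹ j < σ⁻¹ (σ i))
      (fun j => j < i ∧ σ i < σ j) (by intro j; simp [and_comm])]
  tauto

theorem mmp_inv {n : ℕ} (a b c d : ℕ) (σ : Equiv.Perm (Fin n)) :
    mmp a b c d σ⁻¹ = mmp a d c b σ :=
  card_filter_inv σ _ _ (matches_inv a b c d σ)

theorem av_inv {n : ℕ} (σ : Equiv.Perm (Fin n)) (h : σ ∈ Av132 n) : σ⁻¹ ∈ Av132 n := by
  simp only [Av132, Finset.mem_filter, Finset.mem_univ, true_and, Avoids132] at h ⊢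
  rintro ⟨i, j, k, hij, hjk, h1, h2⟩
  exact h ⟨σ⁻¹ i, σ⁻¹ k, σ⁻¹ j, h1, h2, by simpa using hij, by simpa using hjk⟩

/-- For all `a b c d : ℕ` and `n ≥ 1`,
`Q_{n,132}^{(a,b,c,d)}(x) = Q_{n,132}^{(a,d,c,b)}(x)`; equivalently, the map
`σ ↦ σ⁻¹` on 132-avoiding permutations satisfies
`mmp^{(a,b,c,d)}(σ⁻¹) = mmp^{(a,d,c,b)}(σ)`. -/
theorem stmt0 (a b c d n : ℕ) (hn : 1 ≤ n) :
    Q n a b c d = Q n a d c b ∧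
    ∀ σ : Equiv.Perm (Fin n), σ ∈ Av132 n →
      σ⁻¹ ∈ Av132 n ∧ mmp a b c d σ⁻¹ = mmp a d c b σ := by
  refine ⟨?_, fun σ h => ⟨av_inv σ h, mmp_inv a b c d σ⟩⟩
  unfold Q
  refine Finset.sum_bij' (fun σ _ => σ⁻¹) (fun σ _ => σ⁻¹) (fun σ h => av_inv σ h)
    (fun σ h => av_inv σ h) (fun σ _ => inv_inv σ) (fun σ _ => inv_inv σ) ?_
  intro σ _
  rw [mmp_inv a d c b σ]
end

section
/- For all k, ℓ, m ≥ 1 and all n ≥ ℓ, the polynomials Q_{n,132}^{(k,ℓ,m,0)}(x) satisfy the recurrence Q_{n,132}^{(k,ℓ,m,0)}(x) = Σ_{i=1}^{ℓ-1} C_{i-1} · Q_{n-i,132}^{(k,ℓ-i,m,0)}(x) + Σ_{i=ℓ}^{n} Q_{i-1,132}^{(k-1,ℓ,m,0)}(x) · Q_{n-i,132}^{(k,0,m,0)}(x). -/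
open Finset Polynomial

/-- the underlying function of the glued permutation -/
def glueFun {a b : ℕ} (σ : Equiv.Perm (Fin a)) (τ : Equiv.Perm (Fin b)) :
    Fin (a + 1 + b) → Fin (a + 1 + b) :=
  Fin.addCases
    (Fin.lastCases ⟨a + b, by omega⟩ (fun p => ⟨b + σ p, by have := (σ p).2; omega⟩))
    (fun q => ⟨τ q, by have := (τ q).2; omega⟩)

lemma glueFun_L {a b : ℕ} (σ : Equiv.Perm (Fin a)) (τ : Equiv.Perm (Fin b)) (p : Fin a) :
    (glueFun σ τ (Fin.castAdd b p.castSucc)).val = b + σ p := by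
  simp [glueFun]

lemma glueFun_M {a b : ℕ} (σ : Equiv.Perm (Fin a)) (τ : Equiv.Perm (Fin b)) :
    (glueFun σ τ (Fin.castAdd b (Fin.last a))).val = a + b := by
  simp [glueFun]

lemma glueFun_R {a b : ℕ} (σ : Equiv.Perm (Fin a)) (τ : Equiv.Perm (Fin b)) (q : Fin b) :
    (glueFun σ τ (Fin.natAdd (a + 1) q)).val = τ q := by
  simp [glueFun]

lemma pos_cases {a b : ℕ} {P : Fin (a + 1 + b) → Prop}
    (hL : ∀ p : Fin a, P (Fin.castAdd b p.castSucc))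
    (hM : P (Fin.castAdd b (Fin.last a)))
    (hR : ∀ q : Fin b, P (Fin.natAdd (a + 1) q)) : ∀ i, P i := by
  intro i
  induction i using Fin.addCases with
  | left i =>
    induction i using Fin.lastCases with
    | last => exact hM
    | cast p => exact hL p
  | right q => exact hR q

lemma glueFun_inj {a b : ℕ} (σ : Equiv.Perm (Fin a)) (τ : Equiv.Perm (Fin b)) :
    Function.Injective (glueFun σ τ) := by
  intro i j h
  have h' := congrArg Fin.val h
  clear h
  revert i j
  refine pos_cases (fun p => ?_) ?_ (fun q => ?_) <;>
  refine pos_cases (fun p' => ?_) ?_ (fun q' => ?_) <;>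
  intro h <;> simp only [glueFun_L, glueFun_M, glueFun_R] at h
  · have : σ p = σ p' := Fin.ext (by omega)
    rw [σ.injective this]
  · have := (σ p).2; omega
  · have := (τ q').2; omega
  · have := (σ p').2; omega
  · rfl
  · have := (τ q').2; omega
  · have := (τ q).2; omega
  · have := (τ q).2; omega
  · have : τ q = τ q' := Fin.ext (by omega)
    rw [τ.injective this]

/-- the glued permutation: shifted `σ`, the maximum, then `τ` -/
noncomputable def glue {a b : ℕ} (σ : Equiv.Perm (Fin a)) (τ : Equiv.Perm (Fin b)) :
    Equiv.Perm (Fin (a + 1 + b)) :=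
  Equiv.ofBijective (glueFun σ τ) (Finite.injective_iff_bijective.1 (glueFun_inj σ τ))

lemma glue_L {a b : ℕ} (σ : Equiv.Perm (Fin a)) (τ : Equiv.Perm (Fin b)) (p : Fin a) :
    (glue σ τ (Fin.castAdd b p.castSucc)).val = b + σ p := glueFun_L σ τ p

lemma glue_M {a b : ℕ} (σ : Equiv.Perm (Fin a)) (τ : Equiv.Perm (Fin b)) :
    (glue σ τ (Fin.castAdd b (Fin.last a))).val = a + b := glueFun_M σ τ

lemma glue_R {a b : ℕ} (σ : Equiv.Perm (Fin a)) (τ : Equiv.Perm (Fin b)) (q : Fin b) :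
    (glue σ τ (Fin.natAdd (a + 1) q)).val = τ q := glueFun_R σ τ q

lemma card_filter_split {a b : ℕ} (P : Fin (a + 1 + b) → Prop) [DecidablePred P] :
    (univ.filter P).card = (univ.filter (fun p : Fin a => P (Fin.castAdd b p.castSucc))).card
      + (if P (Fin.castAdd b (Fin.last a)) then 1 else 0)
      + (univ.filter (fun q : Fin b => P (Fin.natAdd (a + 1) q))).card := by
  simp only [Finset.card_filter]
  rw [Fin.sum_univ_add, Fin.sum_univ_castSucc]

lemma card_filter_congr' {a : ℕ} {P R : Fin a → Prop} [DecidablePred P] [DecidablePred R]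
    (h : ∀ x, P x ↔ R x) : (univ.filter P).card = (univ.filter R).card := by
  congr 1; ext x; simp [h]

lemma card_filter_none {a : ℕ} {P : Fin a → Prop} [DecidablePred P]
    (h : ∀ x, ¬ P x) : (univ.filter P).card = 0 := by
  simp [Finset.filter_eq_empty_iff, h]

lemma card_filter_all {a : ℕ} {P : Fin a → Prop} [DecidablePred P]
    (h : ∀ x, P x) : (univ.filter P).card = a := by
  simp [h]

lemma matches_L {a b k l m : ℕ} (hk : 1 ≤ k) (σ : Equiv.Perm (Fin a)) (τ : Equiv.Perm (Fin b))
    (p : Fin a) : MatchesMMP k l m 0 (glue σ τ) (Fin.castAdd b p.castSucc) ↔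
      MatchesMMP (k - 1) l m 0 σ p := by
  unfold MatchesMMP
  have hp := p.2
  have hs := (σ p).2
  simp only [card_filter_split, Fin.lt_def, glue_L, glue_M, glue_R, Fin.val_castAdd,
    Fin.val_castSucc, Fin.val_last, Fin.val_natAdd]
  rw [card_filter_congr' (P := fun x : Fin a => (p:ℕ) < x ∧ b + (σ p : ℕ) < b + σ x)
      (R := fun x : Fin a => (p:ℕ) < x ∧ (σ p : ℕ) < σ x) (fun x => by omega),
    card_filter_congr' (P := fun x : Fin a => (x:ℕ) < p ∧ b + (σ p : ℕ) < b + σ x)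
      (R := fun x : Fin a => (x:ℕ) < p ∧ (σ p : ℕ) < σ x) (fun x => by omega),
    card_filter_congr' (P := fun x : Fin a => (x:ℕ) < p ∧ b + (σ x : ℕ) < b + σ p)
      (R := fun x : Fin a => (x:ℕ) < p ∧ (σ x : ℕ) < σ p) (fun x => by omega),
    card_filter_none (P := fun x : Fin b => (p:ℕ) < a + 1 + x ∧ b + (σ p : ℕ) < τ x)
      (fun x => by have := (τ x).2; omega),
    card_filter_none (P := fun x : Fin b => a + 1 + (x:ℕ) < p ∧ b + (σ p : ℕ) < τ x)
      (fun x => by omega),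
    card_filter_none (P := fun x : Fin b => a + 1 + (x:ℕ) < p ∧ (τ x : ℕ) < b + σ p)
      (fun x => by omega), if_pos (by omega), if_neg (by omega), if_neg (by omega)]
  simp only [Nat.zero_le, and_true, add_zero]
  omega

lemma matches_M {a b k l m : ℕ} (hk : 1 ≤ k) (σ : Equiv.Perm (Fin a)) (τ : Equiv.Perm (Fin b)) :
    ¬ MatchesMMP k l m 0 (glue σ τ) (Fin.castAdd b (Fin.last a)) := by
  rintro ⟨h, -⟩
  rw [Finset.filter_eq_empty_iff.2] at h
  · simp at h; omega
  · intro x _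
    rw [Fin.lt_def, Fin.lt_def, glue_M]
    have := (glue σ τ x).2
    omega

lemma matches_R {a b k l m : ℕ} (σ : Equiv.Perm (Fin a)) (τ : Equiv.Perm (Fin b))
    (q : Fin b) : MatchesMMP k l m 0 (glue σ τ) (Fin.natAdd (a + 1) q) ↔
      MatchesMMP k (l - (a + 1)) m 0 τ q := by
  unfold MatchesMMP
  have hq := q.2
  have hs := (τ q).2
  simp only [card_filter_split, Fin.lt_def, glue_L, glue_M, glue_R, Fin.val_castAdd,
    Fin.val_castSucc, Fin.val_last, Fin.val_natAdd]
  rw [card_filter_congr' (P := fun x : Fin b => a + 1 + (q:ℕ) < a + 1 + x ∧ (τ q : ℕ) < τ x)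
      (R := fun x : Fin b => (q:ℕ) < x ∧ (τ q : ℕ) < τ x) (fun x => by omega),
    card_filter_congr' (P := fun x : Fin b => a + 1 + (x:ℕ) < a + 1 + q ∧ (τ q : ℕ) < τ x)
      (R := fun x : Fin b => (x:ℕ) < q ∧ (τ q : ℕ) < τ x) (fun x => by omega),
    card_filter_congr' (P := fun x : Fin b => a + 1 + (x:ℕ) < a + 1 + q ∧ (τ x : ℕ) < τ q)
      (R := fun x : Fin b => (x:ℕ) < q ∧ (τ x : ℕ) < τ q) (fun x => by omega),
    card_filter_none (P := fun x : Fin a => a + 1 + (q:ℕ) < x ∧ (τ q : ℕ) < b + σ x)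
      (fun x => by omega),
    card_filter_all (P := fun x : Fin a => (x:ℕ) < a + 1 + q ∧ (τ q : ℕ) < b + σ x)
      (fun x => by omega),
    card_filter_none (P := fun x : Fin a => (x:ℕ) < a + 1 + q ∧ b + (σ x : ℕ) < τ q)
      (fun x => by omega), if_neg (by omega), if_pos (by omega), if_neg (by omega)]
  simp only [Nat.zero_le, and_true, zero_add]
  omega

lemma mmp_glue {a b k l m : ℕ} (hk : 1 ≤ k) (σ : Equiv.Perm (Fin a)) (τ : Equiv.Perm (Fin b)) :
    mmp k l m 0 (glue σ τ) = mmp (k - 1) l m 0 σ + mmp k (l - (a + 1)) m 0 τ := by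
  unfold mmp
  rw [card_filter_split, if_neg (matches_M hk σ τ),
    card_filter_congr' (fun p => matches_L hk σ τ p), card_filter_congr' (fun q => matches_R σ τ q)]
  rfl

lemma avoids_glue {a b : ℕ} (σ : Equiv.Perm (Fin a)) (τ : Equiv.Perm (Fin b)) :
    Avoids132 (glue σ τ) ↔ Avoids132 σ ∧ Avoids132 τ := by
  constructor
  · intro h
    constructor
    · rintro ⟨i, j, k, h1, h2, h3, h4⟩
      refine h ⟨Fin.castAdd b i.castSucc, Fin.castAdd b j.castSucc, Fin.castAdd b k.castSucc, ?_⟩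
      simp only [Fin.lt_def, glue_L, Fin.val_castAdd, Fin.val_castSucc] at *
      omega
    · rintro ⟨i, j, k, h1, h2, h3, h4⟩
      refine h ⟨Fin.natAdd (a + 1) i, Fin.natAdd (a + 1) j, Fin.natAdd (a + 1) k, ?_⟩
      simp only [Fin.lt_def, glue_R, Fin.val_natAdd] at *
      omega
  · rintro ⟨hσ, hτ⟩ ⟨i, j, k, h⟩
    revert i j k
    refine pos_cases (fun p => ?_) ?_ (fun q => ?_) <;>
    refine pos_cases (fun p' => ?_) ?_ (fun q' => ?_) <;>
    refine pos_cases (fun p'' => ?_) ?_ (fun q'' => ?_) <;>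
    simp only [Fin.lt_def, glue_L, glue_M, glue_R, Fin.val_castAdd,
      Fin.val_castSucc, Fin.val_last, Fin.val_natAdd] <;> rintro ⟨h1, h2, h3, h4⟩
    · exact hσ ⟨p, p', p'', by simp only [Fin.lt_def]; omega⟩
    all_goals try omega
    all_goals first
      | exact hτ ⟨q, q', q'', by simp only [Fin.lt_def]; omega⟩

lemma glue_inj {a b : ℕ} {σ σ' : Equiv.Perm (Fin a)} {τ τ' : Equiv.Perm (Fin b)}
    (h : glue σ τ = glue σ' τ') : σ = σ' ∧ τ = τ' := by
  constructor
  · ext p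
    have := glue_L σ τ p
    rw [h, glue_L] at this
    omega
  · ext q
    have := glue_R σ τ q
    rw [h, glue_R] at this
    omega

lemma glue_surj {a b : ℕ} (ρ : Equiv.Perm (Fin (a + 1 + b))) (hρ : Avoids132 ρ)
    (hM : (ρ (Fin.castAdd b (Fin.last a))).val = a + b) : ∃ σ τ, glue σ τ = ρ := by
  have key : ∀ (p : Fin a) (q : Fin b),
      (ρ (Fin.natAdd (a + 1) q)).val < (ρ (Fin.castAdd b p.castSucc)).val := by
    intro p q
    by_contra hc
    have hne : (ρ (Fin.natAdd (a + 1) q)).val ≠ (ρ (Fin.castAdd b p.castSucc)).val := by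
      intro h
      have := congrArg Fin.val (ρ.injective (Fin.ext h))
      simp at this
      omega
    have hne2 : (ρ (Fin.natAdd (a + 1) q)).val ≠ (ρ (Fin.castAdd b (Fin.last a))).val := by
      intro h
      have := congrArg Fin.val (ρ.injective (Fin.ext h))
      simp at this
      omega
    have h3 := (ρ (Fin.natAdd (a + 1) q)).2
    refine hρ ⟨Fin.castAdd b p.castSucc, Fin.castAdd b (Fin.last a), Fin.natAdd (a + 1) q, ?_⟩
    simp only [Fin.lt_def, Fin.val_castAdd, Fin.val_castSucc, Fin.val_last, Fin.val_natAdd]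
    omega
  have hR : ∀ q : Fin b, (ρ (Fin.natAdd (a + 1) q)).val < b := by
    intro q
    have h1 : (univ.image (fun i : Fin (a + 1) => ρ (Fin.castAdd b i))) ⊆
        Finset.Ioi (ρ (Fin.natAdd (a + 1) q)) := by
      intro v hv
      simp only [mem_image, mem_univ, true_and] at hv
      obtain ⟨i, rfl⟩ := hv
      rw [Finset.mem_Ioi, Fin.lt_def]
      induction i using Fin.lastCases with
      | cast p => exact key p q
      | last =>
        have hne2 : (ρ (Fin.natAdd (a + 1) q)).val ≠ (ρ (Fin.castAdd b (Fin.last a))).val := by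
          intro h
          have := congrArg Fin.val (ρ.injective (Fin.ext h))
          simp at this
          omega
        have h3 := (ρ (Fin.natAdd (a + 1) q)).2
        omega
    have h2 := Finset.card_le_card h1
    rw [Finset.card_image_of_injective, Fin.card_Ioi] at h2
    · simp at h2
      omega
    · exact ρ.injective.comp (Fin.castAdd_injective _ _)
  have hL : ∀ p : Fin a, b ≤ (ρ (Fin.castAdd b p.castSucc)).val ∧
      (ρ (Fin.castAdd b p.castSucc)).val < a + b := by
    intro p
    constructor
    · have h1 : (univ.image (fun i : Fin b => ρ (Fin.natAdd (a + 1) i))) ⊆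
          Finset.Iio (ρ (Fin.castAdd b p.castSucc)) := by
        intro v hv
        simp only [mem_image, mem_univ, true_and] at hv
        obtain ⟨i, rfl⟩ := hv
        rw [Finset.mem_Iio, Fin.lt_def]
        exact key p i
      have h2 := Finset.card_le_card h1
      rw [Finset.card_image_of_injective, Fin.card_Iio] at h2
      · simpa using h2
      · exact ρ.injective.comp (Fin.natAdd_injective _ _)
    · have hne2 : (ρ (Fin.castAdd b p.castSucc)).val ≠ (ρ (Fin.castAdd b (Fin.last a))).val := by
        intro h
        have := congrArg Fin.val (ρ.injective (Fin.ext h))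
        simp at this
        omega
      have h3 := (ρ (Fin.castAdd b p.castSucc)).2
      omega
  let f : Fin a → Fin a := fun p => ⟨(ρ (Fin.castAdd b p.castSucc)).val - b, by
    have := hL p; omega⟩
  let g : Fin b → Fin b := fun q => ⟨(ρ (Fin.natAdd (a + 1) q)).val, hR q⟩
  have hf : Function.Injective f := by
    intro p p' h
    have h := congrArg Fin.val h
    simp only [f] at h
    have h1 := hL p
    have h2 := hL p'
    have := congrArg Fin.val (ρ.injective (Fin.ext (by omega :
      (ρ (Fin.castAdd b p.castSucc)).val = (ρ (Fin.castAdd b p'.castSucc)).val)))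
    exact Fin.ext (by simpa using this)
  have hg : Function.Injective g := by
    intro p p' h
    have h := congrArg Fin.val h
    simp only [g] at h
    have := congrArg Fin.val (ρ.injective (Fin.ext h))
    exact Fin.ext (by simpa using this)
  refine ⟨Equiv.ofBijective f (Finite.injective_iff_bijective.1 hf),
    Equiv.ofBijective g (Finite.injective_iff_bijective.1 hg), ?_⟩
  refine Equiv.ext (pos_cases (fun p => ?_) ?_ (fun q => ?_))
  · apply Fin.ext
    rw [glue_L]
    have := hL p
    simp only [Equiv.ofBijective_apply, f]
    omega
  · apply Fin.ext
    rw [glue_M, hM]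
  · apply Fin.ext
    rw [glue_R]
    simp only [Equiv.ofBijective_apply, g]

lemma fiber {a b k l m : ℕ} (hk : 1 ≤ k) :
    ∑ ρ ∈ (Av132 (a + 1 + b)).filter
        (fun ρ => (ρ (Fin.castAdd b (Fin.last a))).val = a + b), (X : ℤ[X]) ^ mmp k l m 0 ρ =
      Q a (k - 1) l m 0 * Q b k (l - (a + 1)) m 0 := by
  unfold Q
  rw [Finset.sum_mul_sum, ← Finset.sum_product']
  symm
  refine Finset.sum_bij (fun x _ => glue x.1 x.2) ?_ ?_ ?_ ?_
  · rintro ⟨σ, τ⟩ h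
    simp only [Av132, mem_product, mem_filter, mem_univ, true_and] at h ⊢
    exact ⟨(avoids_glue σ τ).2 h, glue_M σ τ⟩
  · rintro ⟨σ, τ⟩ _ ⟨σ', τ'⟩ _ h
    obtain ⟨h1, h2⟩ := glue_inj h
    exact Prod.ext h1 h2
  · intro ρ h
    simp only [Av132, mem_filter, mem_univ, true_and] at h
    obtain ⟨σ, τ, rfl⟩ := glue_surj ρ h.1 h.2
    refine ⟨(σ, τ), ?_, rfl⟩
    simp only [Av132, mem_product, mem_filter, mem_univ, true_and]
    exact (avoids_glue σ τ).1 h.1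
  · rintro ⟨σ, τ⟩ _
    rw [mmp_glue hk, pow_add]

lemma fiber' {n k l m : ℕ} (hk : 1 ≤ k) (i : Fin (n + 1)) :
    ∑ ρ ∈ (Av132 (n + 1)).filter
        (fun ρ => ρ.symm (Fin.last n) = i), (X : ℤ[X]) ^ mmp k l m 0 ρ =
      Q i (k - 1) l m 0 * Q (n - i) k (l - (i + 1)) m 0 := by
  obtain ⟨a, ha⟩ := i
  obtain ⟨b, hb⟩ : ∃ b, n + 1 = a + 1 + b := ⟨n - a, by omega⟩
  have hb' : n - a = b := by omega
  simp only [hb']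
  rw [← fiber hk]
  have hcond : (Av132 (n + 1)).filter (fun ρ => ρ.symm (Fin.last n) = ⟨a, ha⟩) =
      (Av132 (n + 1)).filter (fun ρ => (ρ ⟨a, ha⟩).val = a + b) := by
    apply Finset.filter_congr
    intro ρ _
    rw [Equiv.symm_apply_eq, Fin.ext_iff, Fin.val_last]
    omega
  rw [hcond]
  clear hcond
  generalize n + 1 = N at hb ha
  subst hb
  rfl

lemma Q_rec (n k l m : ℕ) (hk : 1 ≤ k) :
    Q (n + 1) k l m 0 = ∑ i : Fin (n + 1),
      Q i (k - 1) l m 0 * Q (n - i) k (l - (i + 1)) m 0 := by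
  rw [Q, ← Finset.sum_fiberwise (Av132 (n + 1)) (fun ρ => ρ.symm (Fin.last n))]
  exact Finset.sum_congr rfl (fun i _ => fiber' hk i)

lemma eval_Q (n a b c d : ℕ) : (Q n a b c d).eval 1 = ((Av132 n).card : ℤ) := by
  simp [Q, Polynomial.eval_finsetSum]

lemma card_Av (n : ℕ) : (Av132 n).card = catalan n := by
  induction n using Nat.strong_induction_on with
  | _ n ih =>
    cases n with
    | zero =>
      rw [catalan_zero]
      rfl
    | succ n =>
      have h := congrArg (Polynomial.eval 1) (Q_rec n 1 1 1 le_rfl)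
      simp only [Polynomial.eval_finsetSum, Polynomial.eval_mul, eval_Q] at h
      rw [catalan_succ]
      have h' : (Av132 (n + 1)).card =
          ∑ i : Fin (n + 1), (Av132 i).card * (Av132 (n - i)).card := by exact_mod_cast h
      rw [h']
      refine Finset.sum_congr rfl (fun i _ => ?_)
      rw [ih i i.2, ih (n - i) (by omega)]

lemma Q_small (n a l c d : ℕ) (h : n < l) : Q n a l c d = (catalan n : ℤ[X]) := by
  unfold Q
  rw [← card_Av, Finset.sum_congr rfl (g := fun _ => 1)]
  · simp
  · intro σ _
    have : mmp a l c d σ = 0 := by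
      apply card_filter_none
      rintro x ⟨-, h2, -⟩
      have := h2.trans (Finset.card_le_univ _)
      simp at this
      omega
    rw [this, pow_zero]

/-- the recurrence for `Q_{n,132}^{(k,ℓ,m,0)}(x)` for `k,ℓ,m ≥ 1`, `n ≥ ℓ`. -/
theorem stmt1 (k l m n : ℕ) (hk : 1 ≤ k) (hl : 1 ≤ l) (hm : 1 ≤ m) (hn : l ≤ n) :
    Q n k l m 0 =
      (∑ i ∈ Finset.Icc 1 (l - 1),
        (catalan (i - 1) : Polynomial ℤ) * Q (n - i) k (l - i) m 0) +
      ∑ i ∈ Finset.Icc l n, Q (i - 1) (k - 1) l m 0 * Q (n - i) k 0 m 0 := by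
  have h1 : Q n k l m 0 = ∑ i ∈ Finset.Ico 1 (n + 1),
      Q (i - 1) (k - 1) l m 0 * Q (n - i) k (l - i) m 0 := by
    obtain ⟨N, rfl⟩ : ∃ N, n = N + 1 := ⟨n - 1, by omega⟩
    rw [Q_rec N k l m hk, Fin.sum_univ_eq_sum_range
      (fun i => Q i (k - 1) l m 0 * Q (N - i) k (l - (i + 1)) m 0), Finset.sum_Ico_eq_sum_range]
    refine Finset.sum_congr (by simp) (fun i _ => ?_)
    rw [show 1 + i - 1 = i by omega, show N + 1 - (1 + i) = N - i by omega, add_comm 1 i]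
  rw [h1, ← Finset.sum_Ico_consecutive _ hl (by omega : l ≤ n + 1)]
  congr 1
  · refine Finset.sum_congr (by ext; simp; omega) (fun i hi => ?_)
    rw [Finset.mem_Icc] at hi
    rw [Q_small (i - 1) (k - 1) l m 0 (by omega)]
  · refine Finset.sum_congr (by ext; simp only [Finset.mem_Ico, Finset.mem_Icc]; omega) (fun i hi => ?_)
    rw [Finset.mem_Icc] at hi
    rw [show l - i = 0 by omega]
end

section
/- For all n ≥ 5, the coefficient of x^{n-4} in the polynomial Q_{n,132}^{(1,1,1,0)}(x) equals 6 + 2·binom(n-2, 2). -/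
open Finset Polynomial

/-- Working copy of a 132-avoiding permutation as a function on `ℕ`. -/
def NGood (n : ℕ) (f : ℕ → ℕ) : Prop :=
  (∀ i < n, f i < n) ∧ (∀ i < n, ∀ j < n, f i = f j → i = j) ∧
  (∀ i j k, i < j → j < k → k < n → f i < f k → f k < f j → False)

/-- Position `i` does not match the mesh pattern. -/
def NBad (n : ℕ) (f : ℕ → ℕ) (i : ℕ) : Prop :=
  (∀ j < n, i < j → f j ≤ f i) ∨ (∀ j < i, f j ≤ f i) ∨ (∀ j < i, f i ≤ f j)

theorem NGood.surj {n : ℕ} {f : ℕ → ℕ} (h : NGood n f) (v : ℕ) (hv : v < n) :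
    ∃ i < n, f i = v := by
  have h1 : Set.InjOn f (range n : Finset ℕ) := by
    intro i hi j hj hij
    exact h.2.1 i (by simpa using hi) j (by simpa using hj) hij
  have h2 : (range n).image f = range n := by
    apply Finset.eq_of_subset_of_card_le
    · intro x hx
      obtain ⟨i, hi, rfl⟩ := Finset.mem_image.1 hx
      exact Finset.mem_range.2 (h.1 i (Finset.mem_range.1 hi))
    · rw [Finset.card_image_of_injOn h1]
  have h3 : v ∈ (range n).image f := by rw [h2]; exact Finset.mem_range.2 hv
  obtain ⟨i, hi, e⟩ := Finset.mem_image.1 h3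
  exact ⟨i, Finset.mem_range.1 hi, e⟩

theorem NGood.not_lt {n : ℕ} {f g : ℕ → ℕ} (hf : NGood n f) (hg : NGood n g)
    (i : ℕ) (hi : i < n) (ih : ∀ j < i, f j = g j) (hm : ∃ j < i, f j < f i)
    (hlt : f i < g i) : False := by
  obtain ⟨k, hk, e⟩ := hg.surj (f i) (hf.1 i hi)
  obtain ⟨j, hj, hj2⟩ := hm
  rcases lt_trichotomy k i with h | h | h
  · have := hf.2.1 k hk i hi (by rw [ih k h, e])
    omega
  · subst h; omega
  · have := ih j hj
    exact hg.2.2 j i k hj h hk (by omega) (by omega)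

theorem NGood.unique {n : ℕ} {f g : ℕ → ℕ} (hf : NGood n f) (hg : NGood n g)
    (h1 : ∀ i < n, (∀ j < i, f i < f j) → f i = g i)
    (h2 : ∀ i < n, (∀ j < i, g i < g j) → f i = g i) : ∀ i < n, f i = g i := by
  intro i
  induction i using Nat.strong_induction_on with
  | _ i ih =>
    intro hi
    have ih' : ∀ j < i, f j = g j := fun j hj => ih j hj (by omega)
    by_cases a : ∀ j < i, f i < f j
    · exact h1 i hi a
    by_cases b : ∀ j < i, g i < g j
    · exact h2 i hi b
    push Not at a b
    have a' : ∃ j < i, f j < f i := by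
      obtain ⟨j, hj, h⟩ := a
      refine ⟨j, hj, lt_of_le_of_ne h ?_⟩
      intro e
      have := hf.2.1 j (by omega) i hi e
      omega
    have b' : ∃ j < i, g j < g i := by
      obtain ⟨j, hj, h⟩ := b
      refine ⟨j, hj, lt_of_le_of_ne h ?_⟩
      intro e
      have := hg.2.1 j (by omega) i hi e
      omega
    rcases lt_trichotomy (f i) (g i) with h | h | h
    · exact (hf.not_lt hg i hi ih' a' h).elim
    · exact h
    · exact (hg.not_lt hf i hi (fun j hj => (ih' j hj).symm) b' h).elim

/-- The main family. -/
def famG (n a k s i : ℕ) : ℕ :=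
  if i = 0 then n - 1 - s
  else if i ≤ k then (if a + i - 1 = n - 2 then n - 2 + s else a + i - 1)
  else if i ≤ k + a then (if i - k - 1 = n - 2 then n - 2 + s else i - k - 1)
  else (if i - 1 = n - 2 then n - 2 + s else i - 1)

/-- First exceptional permutation. -/
def famA (n i : ℕ) : ℕ := if i = 0 then n - 3 else if i ≤ n - 3 then i - 1 else i

/-- Second exceptional permutation. -/
def famB (n i : ℕ) : ℕ := if i ≤ 1 then n - 3 + i else if i ≤ n - 2 then i - 2 else i

theorem famA_spec (n i : ℕ) (hn : 5 ≤ n) (hi : i < n) : (i = 0 ∧ famA n i + 3 = n) ∨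
   (1 ≤ i ∧ i + 3 ≤ n ∧ famA n i + 1 = i) ∨ (n < i + 3 ∧ famA n i = i) := by
  grind [famA]
theorem famB_spec (n i : ℕ) (hn : 5 ≤ n) (hi : i < n) : (i ≤ 1 ∧ famB n i + 3 = n + i) ∨
   (2 ≤ i ∧ i + 2 ≤ n ∧ famB n i + 2 = i) ∨ (i + 1 = n ∧ famB n i = i) := by
  grind [famB]
theorem famG_spec {n a k s : ℕ} (hn : 5 ≤ n) (ha : 1 ≤ a) (hk : 1 ≤ k) (hak : a + k ≤ n - 1)
    (hs : s ≤ 1) (i : ℕ) (hi : i < n) :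
    (i = 0 ∧ famG n a k s i + s + 1 = n) ∨
    (1 ≤ i ∧ i ≤ k ∧ famG n a k s i + 1 = a + i ∧ a + i + 1 < n) ∨
    (1 ≤ i ∧ i ≤ k ∧ famG n a k s i + 2 = n + s ∧ a + i + 1 = n) ∨
    (k < i ∧ i ≤ k + a ∧ famG n a k s i + k + 1 = i) ∨
    (k + a < i ∧ famG n a k s i + 1 = i ∧ i + 1 < n) ∨
    (k + a < i ∧ famG n a k s i + 2 = n + s ∧ i + 1 = n) := by
  unfold famG
  by_cases h0 : i = 0
  · left
    rw [if_pos h0]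
    omega
  rw [if_neg h0]
  by_cases h1 : i ≤ k
  · rw [if_pos h1]
    by_cases h2 : a + i - 1 = n - 2
    · rw [if_pos h2]
      right; right; left
      omega
    · rw [if_neg h2]
      right; left
      omega
  rw [if_neg h1]
  right; right; right
  by_cases h3 : i ≤ k + a
  · rw [if_pos h3, if_neg (by omega)]
    left
    omega
  rw [if_neg h3]
  right
  by_cases h2 : i - 1 = n - 2
  · rw [if_pos h2]
    right
    omega
  · rw [if_neg h2]
    left
    omega

theorem famG_good {n a k s : ℕ} (hn : 5 ≤ n) (ha : 1 ≤ a) (hk : 1 ≤ k) (hak : a + k ≤ n - 1)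
    (hs : s ≤ 1) : NGood n (famG n a k s) := by
  have sp := famG_spec hn ha hk hak hs
  refine ⟨?_, ?_, ?_⟩
  · intro i hi
    have := sp i hi
    omega
  · intro i hi j hj e
    have h1 := sp i hi
    have h2 := sp j hj
    rw [e] at h1
    generalize famG n a k s j = y at *
    clear sp e
    rcases h1 with h1 | h1 | h1 | h1 | h1 | h1 <;> omega
  · intro i j l hij hjl hl e1 e2
    have h1 := sp i (by omega)
    have h2 := sp j (by omega)
    have h3 := sp l (by omega)
    clear sp
    generalize famG n a k s i = x at *
    generalize famG n a k s j = y at *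
    generalize famG n a k s l = z at *
    rcases h2 with h2 | h2 | h2 | h2 | h2 | h2 <;>
      rcases h3 with h3 | h3 | h3 | h3 | h3 | h3 <;> omega

theorem famA_good {n : ℕ} (hn : 5 ≤ n) : NGood n (famA n) := by
  refine ⟨?_, ?_, ?_⟩
  · intro i hi
    unfold famA
    split_ifs <;> omega
  · intro i hi j hj
    unfold famA
    split_ifs <;> omega
  · intro i j l hij hjl hl
    unfold famA
    split_ifs <;> omega

theorem famB_good {n : ℕ} (hn : 5 ≤ n) : NGood n (famB n) := by
  refine ⟨?_, ?_, ?_⟩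
  · intro i hi
    unfold famB
    split_ifs <;> omega
  · intro i hi j hj
    unfold famB
    split_ifs <;> omega
  · intro i j l hij hjl hl
    unfold famB
    split_ifs <;> omega

/-- Exactly the four positions `0, 1, x, n-1` are bad. -/
def FourBad (n : ℕ) (f : ℕ → ℕ) (x : ℕ) : Prop :=
  2 ≤ x ∧ x ≤ n - 2 ∧ ∀ i < n, NBad n f i ↔ (i = 0 ∨ i = 1 ∨ i = x ∨ i = n - 1)

theorem NBad.first {n : ℕ} {f : ℕ → ℕ} : NBad n f 0 := Or.inr (Or.inl (by intro j hj; omega))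

theorem NBad.second {n : ℕ} {f : ℕ → ℕ} : NBad n f 1 := by
  rcases le_total (f 0) (f 1) with h | h
  · refine Or.inr (Or.inl ?_)
    intro j hj
    obtain rfl : j = 0 := by omega
    exact h
  · refine Or.inr (Or.inr ?_)
    intro j hj
    obtain rfl : j = 0 := by omega
    exact h

theorem NBad.last {n : ℕ} {f : ℕ → ℕ} : NBad n f (n - 1) :=
  Or.inl (by intro j hj; omega)

theorem not_NBad {n : ℕ} {f : ℕ → ℕ} {i : ℕ} (x y z : ℕ) (hx : x < n) (hix : i < x)
    (h1 : f i < f x) (hy : y < i) (h2 : f i < f y) (hz : z < i) (h3 : f z < f i) :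
    ¬ NBad n f i := by
  rintro (h | h | h)
  · have := h x hx hix; omega
  · have := h y hy; omega
  · have := h z hz; omega

theorem fourBad_of {n : ℕ} {f : ℕ → ℕ} {x : ℕ} (h2 : 2 ≤ x) (hx : x ≤ n - 2) (hb : NBad n f x)
    (h : ∀ i < n, 2 ≤ i → i ≤ n - 2 → i ≠ x → ¬ NBad n f i) : FourBad n f x := by
  refine ⟨h2, hx, ?_⟩
  intro i hi
  constructor
  · intro hbi
    by_contra hc
    push Not at hc
    exact h i hi (by omega) (by omega) hc.2.2.1 hbi
  · rintro (rfl | rfl | rfl | rfl)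
    · exact NBad.first
    · exact NBad.second
    · exact hb
    · exact NBad.last

theorem famA_four {n : ℕ} (hn : 5 ≤ n) : FourBad n (famA n) (n - 2) := by
  refine fourBad_of (by omega) (by omega) ?_ ?_
  · right; left
    intro j hj
    have := famA_spec n j hn (by omega)
    have := famA_spec n (n - 2) hn (by omega)
    omega
  · intro i hi h2 h3 h4
    have hv0 := famA_spec n (i) hn (by omega)
    have hv1 := famA_spec n (n - 1) hn (by omega)
    have hv2 := famA_spec n (0) hn (by omega)
    have hv3 := famA_spec n (1) hn (by omega)
    exact not_NBad (n - 1) 0 (1) (by omega) (by omega) (by omega) (by omega) (by omega) (by omega)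
      (by omega)

theorem famB_four {n : ℕ} (hn : 5 ≤ n) : FourBad n (famB n) (2) := by
  refine fourBad_of (by omega) (by omega) ?_ ?_
  · right; right
    intro j hj
    have := famB_spec n j hn (by omega)
    have := famB_spec n (2) hn (by omega)
    omega
  · intro i hi h2 h3 h4
    have hv0 := famB_spec n (i) hn (by omega)
    have hv1 := famB_spec n (n - 1) hn (by omega)
    have hv2 := famB_spec n (0) hn (by omega)
    have hv3 := famB_spec n (2) hn (by omega)
    exact not_NBad (n - 1) 0 (2) (by omega) (by omega) (by omega) (by omega) (by omega) (by omega)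
      (by omega)

theorem famG_four1 {n a k s : ℕ} (hn : 5 ≤ n) (ha : 1 ≤ a) (hk : 1 ≤ k) (hak : a + k ≤ n - 2)
    (hs : s ≤ 1) : FourBad n (famG n a k s) (k + 1) := by
  have sp := famG_spec hn ha hk (by omega) hs
  refine fourBad_of (by omega) (by omega) ?_ ?_
  · right; right
    intro j hj
    have := sp (k + 1) (by omega)
    omega
  · intro i hi h2 h3 h4
    by_cases hik : i ≤ k
    · have hs1 := sp i hi
      have hv0 := sp (n - 1) (by omega)
      have hv1 := sp (0) (by omega)
      have hv2 := sp (1) (by omega)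
      exact not_NBad (n - 1) 0 1 (by omega) (by omega) (by omega) (by omega) (by omega) (by omega) (by omega)
    · have hs1 := sp i hi
      have hv0 := sp (n - 1) (by omega)
      have hv1 := sp (0) (by omega)
      have hv2 := sp (k + 1) (by omega)
      exact not_NBad (n - 1) 0 (k + 1) (by omega) (by omega) (by omega) (by omega) (by omega) (by omega) (by omega)

theorem famG_four2 {n s : ℕ} (hn : 5 ≤ n)
    (hs : s ≤ 1) : FourBad n (famG n 1 (n - 2) s) (n - 2) := by
  have sp := famG_spec hn (le_refl 1) (show 1 ≤ n - 2 by omega) (by omega) hs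
  refine fourBad_of (by omega) (by omega) ?_ ?_
  · left
    intro j hj hj2
    have := sp j hj
    omega
  · intro i hi h2 h3 h4
    have hs1 := sp i hi
    have hv0 := sp (n - 2) (by omega)
    have hv1 := sp (0) (by omega)
    have hv2 := sp (1) (by omega)
    exact not_NBad (n - 2) 0 1 (by omega) (by omega) (by omega) (by omega) (by omega) (by omega) (by omega)

theorem famG_four3 {n s : ℕ} (hn : 5 ≤ n)
    (hs : s ≤ 1) : FourBad n (famG n (n - 2) 1 s) 2 := by
  have sp := famG_spec hn (show 1 ≤ n - 2 by omega) (le_refl 1) (by omega) hs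
  refine fourBad_of (by omega) (by omega) ?_ ?_
  · right; right
    intro j hj
    have := sp 2 (by omega)
    omega
  · intro i hi h2 h3 h4
    have hs1 := sp i hi
    have hv0 := sp (n - 1) (by omega)
    have hv1 := sp (0) (by omega)
    have hv2 := sp (2) (by omega)
    exact not_NBad (n - 1) 0 2 (by omega) (by omega) (by omega) (by omega) (by omega) (by omega) (by omega)

open Classical in
theorem FourBad.card {n : ℕ} {f : ℕ → ℕ} {x : ℕ} (hn : 5 ≤ n) (h : FourBad n f x) :
    ((range n).filter (NBad n f)).card = 4 := by
  obtain ⟨h1, h2, h3⟩ := h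
  have : (range n).filter (NBad n f) = {0, 1, x, n - 1} := by
    ext i
    simp only [Finset.mem_filter, Finset.mem_range, Finset.mem_insert, Finset.mem_singleton]
    constructor
    · rintro ⟨hi, hb⟩
      exact (h3 i hi).1 hb
    · intro hi
      have : i < n := by omega
      exact ⟨this, (h3 i this).2 hi⟩
  rw [this]
  rw [Finset.card_insert_of_notMem, Finset.card_insert_of_notMem, Finset.card_insert_of_notMem,
    Finset.card_singleton]
  all_goals simp only [Finset.mem_insert, Finset.mem_singleton]
  all_goals omega

open Classical in
theorem mem_four {n : ℕ} {f : ℕ → ℕ} (hc : ((range n).filter (NBad n f)).card = 4)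
    {x y z w u : ℕ} (hx : NBad n f x) (hy : NBad n f y) (hz : NBad n f z) (hw : NBad n f w)
    (hu : NBad n f u) (lx : x < n) (ly : y < n) (lz : z < n) (lw : w < n) (lu : u < n)
    (h1 : x ≠ y) (h2 : x ≠ z) (h3 : x ≠ w) (h4 : y ≠ z) (h5 : y ≠ w) (h6 : z ≠ w) :
    u = x ∨ u = y ∨ u = z ∨ u = w := by
  have hcard : ({x, y, z, w} : Finset ℕ).card = 4 := by
    rw [Finset.card_insert_of_notMem, Finset.card_insert_of_notMem, Finset.card_insert_of_notMem,
      Finset.card_singleton]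
    all_goals simp only [Finset.mem_insert, Finset.mem_singleton]
    all_goals omega
  have hsub : ({x, y, z, w} : Finset ℕ) ⊆ (range n).filter (NBad n f) := by
    intro i hi
    simp only [Finset.mem_insert, Finset.mem_singleton] at hi
    simp only [Finset.mem_filter, Finset.mem_range]
    rcases hi with rfl | rfl | rfl | rfl <;> constructor <;> assumption
  have heq := Finset.eq_of_subset_of_card_le hsub (by omega)
  have : u ∈ ({x, y, z, w} : Finset ℕ) := by
    rw [heq]
    simp only [Finset.mem_filter, Finset.mem_range]
    exact ⟨lu, hu⟩
  simpa only [Finset.mem_insert, Finset.mem_singleton] using this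

/-- Positions whose value exceeds the first value are bad. -/
theorem NGood.bad_of_gt {n : ℕ} {f : ℕ → ℕ} (h : NGood n f) {i : ℕ} (hi : i < n)
    (hg : f 0 < f i) : NBad n f i := by
  right; left
  intro j hj
  by_contra hc
  rcases Nat.eq_zero_or_pos j with rfl | hj0
  · omega
  · exact h.2.2 0 j i hj0 hj hi hg (by omega)

theorem NBad.of_min {n : ℕ} {f : ℕ → ℕ} {i : ℕ} (h : ∀ j < i, f i < f j) : NBad n f i :=
  Or.inr (Or.inr fun j hj => (h j hj).le)

open Classical in
theorem card_le_three {n : ℕ} {f : ℕ → ℕ} (h : NGood n f) (hn : 5 ≤ n) (h0 : n - 2 ≤ f 0)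
    (h1 : f 1 = 0) (hc : ((range n).filter (NBad n f)).card = 4) : False := by
  have hsub : (range n).filter (NBad n f) ⊆ {0, 1, n - 1} := by
    intro i hi
    simp only [Finset.mem_filter, Finset.mem_range] at hi
    simp only [Finset.mem_insert, Finset.mem_singleton]
    by_contra hcon
    push Not at hcon
    obtain ⟨hi, hb⟩ := hi
    have e1 : f i ≠ 0 := fun e => by
      have := h.2.1 i hi 1 (by omega) (by omega)
      omega
    have e2 : f i ≠ f 0 := fun e => by
      have := h.2.1 i hi 0 (by omega) e
      omega
    have e3 : f i ≠ f (n - 1) := fun e => by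
      have := h.2.1 i hi (n - 1) (by omega) e
      omega
    have e4 : f (n - 1) ≠ 0 := fun e => by
      have := h.2.1 (n - 1) (by omega) 1 (by omega) (by omega)
      omega
    have e5 : ¬ f (n - 1) < f i := fun e =>
      h.2.2 1 i (n - 1) (by omega) (by omega) (by omega) (by omega) e
    have e6 := h.1 (n - 1) (by omega)
    exact not_NBad (n - 1) 0 1 (by omega) (by omega) (by omega) (by omega) (by omega) (by omega)
      (by omega) hb
  have h3 : ({0, 1, n - 1} : Finset ℕ).card ≤ 3 := Finset.card_le_three
  have := Finset.card_le_card hsub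
  omega

/-- The classification of functions with exactly four bad positions. -/
def NClass (n : ℕ) (f : ℕ → ℕ) : Prop :=
  (∃ a k s, s ≤ 1 ∧ ((1 ≤ a ∧ 1 ≤ k ∧ a + k ≤ n - 2) ∨ (a = 1 ∧ k = n - 2) ∨
      (a = n - 2 ∧ k = 1)) ∧ ∀ i < n, f i = famG n a k s i) ∨
  (∀ i < n, f i = famA n i) ∨ (∀ i < n, f i = famB n i)

theorem eq_famG {n : ℕ} {f : ℕ → ℕ} (h : NGood n f) (hn : 5 ≤ n) {p s : ℕ} (hp : p < n)
    (hp2 : 2 ≤ p) (hfp : f p = 0) (hs : s ≤ 1) (h0 : f 0 = n - 1 - s) (h1 : 1 ≤ f 1)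
    (h1' : f 1 ≤ n - 2 ∨ (f 1 = n - 2 + s ∧ p = 2))
    (hb : f 1 ≤ n - 2 → f 1 + (p - 1) ≤ n - 1)
    (hmin : ∀ i < n, (∀ j < i, f i < f j) → i = 0 ∨ i = 1 ∨ i = p) :
    ∀ i < n, f i = famG n (min (f 1) (n - 2)) (p - 1) s i := by
  have hg : NGood n (famG n (min (f 1) (n - 2)) (p - 1) s) := by
    apply famG_good <;> omega
  have sp := famG_spec (n := n) (a := min (f 1) (n - 2)) (k := p - 1) hn (by omega) (by omega)
    (by omega) hs
  have e0 : f 0 = famG n (min (f 1) (n - 2)) (p - 1) s 0 := by simp [famG, h0]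
  have hne : f 1 ≠ f 0 := fun e => by
    have := h.2.1 1 (by omega) 0 (by omega) e
    omega
  have e1 : f 1 = famG n (min (f 1) (n - 2)) (p - 1) s 1 := by
    have := sp 1 (by omega)
    omega
  have ep : f p = famG n (min (f 1) (n - 2)) (p - 1) s p := by
    have := sp p (by omega)
    omega
  apply h.unique hg
  · intro i hi hm
    rcases hmin i hi hm with rfl | rfl | rfl
    · exact e0
    · exact e1
    · exact ep
  · intro i hi hm
    by_cases i0 : i = 0
    · rw [i0]; exact e0
    by_cases i1 : i = 1
    · rw [i1]; exact e1
    by_cases ip : i = p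
    · rw [ip]; exact ep
    exfalso
    by_cases hip : i < p
    · have := hm 1 (by omega)
      have := sp i hi
      omega
    · have := hm p (by omega)
      rw [← ep] at this
      omega

open Classical in
theorem classify {n : ℕ} {f : ℕ → ℕ} (h : NGood n f) (hn : 5 ≤ n)
    (hc : ((range n).filter (NBad n f)).card = 4) : NClass n f := by
  have ne : ∀ i < n, ∀ j < n, i ≠ j → f i ≠ f j := fun i hi j hj hij e => hij (h.2.1 i hi j hj e)
  obtain ⟨p, hp, hfp⟩ := h.surj 0 (by omega)
  have bp : NBad n f p := Or.inr (Or.inr fun j _ => by omega)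
  have b0 : NBad n f 0 := NBad.first
  have b1 : NBad n f 1 := NBad.second
  have bl : NBad n f (n - 1) := NBad.last
  have l0 := h.1 0 (by omega)
  have l1 := h.1 1 (by omega)
  have l2 := h.1 2 (by omega)
  -- left-to-right minima do not come after `p`
  have minp : ∀ i < n, (∀ j < i, f i < f j) → i ≤ p := by
    intro i hi hm
    by_contra hcon
    have := hm p (by omega)
    omega
  obtain ⟨t, ht, hft⟩ := h.surj (n - 1) (by omega)
  obtain ⟨u, hu, hfu⟩ := h.surj (n - 2) (by omega)
  obtain ⟨r, hr, hfr⟩ := h.surj (n - 3) (by omega)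
  by_cases c0 : f 0 = 0
  · have hb : ∀ i < n, NBad n f i := by
      intro i hi
      by_cases i0 : i = 0
      · rw [i0]; exact b0
      · have := ne i hi 0 (by omega) i0
        exact h.bad_of_gt hi (by omega)
    have := mem_four hc (hb 0 (by omega)) (hb 1 (by omega)) (hb 2 (by omega)) (hb 3 (by omega))
      (hb 4 (by omega)) (by omega) (by omega) (by omega) (by omega) (by omega) (by omega)
      (by omega) (by omega) (by omega) (by omega) (by omega)
    omega
  have hp0 : p ≠ 0 := fun e => by rw [e] at hfp; omega
  by_cases c1 : f 0 < n - 3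
  · have := mem_four hc (h.bad_of_gt ht (by omega)) (h.bad_of_gt hu (by omega))
      (h.bad_of_gt hr (by omega)) b0 bp ht hu hr (by omega) hp
      (fun e => by rw [e] at hft; omega) (fun e => by rw [e] at hft; omega)
      (fun e => by rw [e] at hft; omega) (fun e => by rw [e] at hfu; omega)
      (fun e => by rw [e] at hfu; omega) (fun e => by rw [e] at hfr; omega)
    rcases this with e | e | e | e <;> rw [e] at hfp <;> omega
  by_cases c2 : f 0 = n - 3
  · have t0 : t ≠ 0 := fun e => by rw [e] at hft; omega
    have u0 : u ≠ 0 := fun e => by rw [e] at hfu; omega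
    have tu : t ≠ u := fun e => by rw [e] at hft; omega
    have tp : t ≠ p := fun e => by rw [e] at hft; omega
    have up : u ≠ p := fun e => by rw [e] at hfu; omega
    have key : ∀ i < n, NBad n f i → i = 0 ∨ i = t ∨ i = u ∨ i = p := fun i hi hb =>
      mem_four hc b0 (h.bad_of_gt ht (by omega)) (h.bad_of_gt hu (by omega)) bp hb
        (by omega) ht hu hp hi (by omega) (by omega) (by omega) (by omega) (by omega) (by omega)
    have key2 : ∀ i < n, (∀ j < i, f i < f j) → i = 0 ∨ i = p := by
      intro i hi hm
      rcases key i hi (NBad.of_min hm) with e | e | e | e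
      · exact Or.inl e
      · have := hm 0 (by omega)
        rw [e] at this; omega
      · have := hm 0 (by omega)
        rw [e] at this; omega
      · exact Or.inr e
    have n10 := ne 1 (by omega) 0 (by omega) (by omega)
    by_cases c3 : f 1 < f 0
    · have hp1 : p = 1 := by
        have := key2 1 (by omega) (fun j hj => by
          obtain rfl : j = 0 := by omega
          exact c3)
        omega
      right; left
      rw [hp1] at hfp
      have e0 : f 0 = famA n 0 := by
        have := famA_spec n 0 hn (by omega)
        omega
      have e1 : f 1 = famA n 1 := by
        have := famA_spec n 1 hn (by omega)
        omega
      apply h.unique (famA_good hn)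
      · intro i hi hm
        rcases key2 i hi hm with e | e
        · rw [e, e0]
        · rw [e, hp1, e1]
      · intro i hi hm
        by_cases i0 : i = 0
        · rw [i0, e0]
        by_cases i1 : i = 1
        · rw [i1, e1]
        have := hm 1 (by omega)
        omega
    · have hu1 : u = 1 := by
        by_contra hu1
        have n1u := ne 1 (by omega) u hu (by omega)
        exact h.2.2 0 1 u (by omega) (by omega) hu (by omega) (by omega)
      rw [hu1] at hfu
      have n20 := ne 2 (by omega) 0 (by omega) (by omega)
      have n21 := ne 2 (by omega) 1 (by omega) (by omega)
      by_cases c4 : f 2 < f 0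
      · have hp2 : p = 2 := by
          have := key2 2 (by omega) (fun j hj => by
            have : j = 0 ∨ j = 1 := by omega
            rcases this with rfl | rfl <;> omega)
          omega
        right; right
        rw [hp2] at hfp
        have e0 : f 0 = famB n 0 := by
          have := famB_spec n 0 hn (by omega)
          omega
        have e1 : f 1 = famB n 1 := by
          have := famB_spec n 1 hn (by omega)
          omega
        have e2 : f 2 = famB n 2 := by
          have := famB_spec n 2 hn (by omega)
          omega
        apply h.unique (famB_good hn)
        · intro i hi hm
          rcases key2 i hi hm with e | e
          · rw [e, e0]
          · rw [e, hp2, e2]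
        · intro i hi hm
          by_cases i0 : i = 0
          · rw [i0, e0]
          by_cases i1 : i = 1
          · rw [i1, e1]
          by_cases i2 : i = 2
          · rw [i2, e2]
          have := hm 2 (by omega)
          omega
      · exfalso
        have ht2 : t = 2 := by
          by_contra hne
          have := ne 2 (by omega) t ht (by omega)
          omega
        rw [ht2] at hft
        have n30 := ne 3 (by omega) 0 (by omega) (by omega)
        have n31 := ne 3 (by omega) 1 (by omega) (by omega)
        have n32 := ne 3 (by omega) 2 (by omega) (by omega)
        have l3 := h.1 3 (by omega)
        have hp3 := key2 3 (by omega) (fun j hj => by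
            have : j = 0 ∨ j = 1 ∨ j = 2 := by omega
            rcases this with rfl | rfl | rfl <;> omega)
        have := key (n - 1) (by omega) bl
        omega
  -- now `f 0` is one of the two largest values
  obtain ⟨s, hs, h0⟩ : ∃ s, s ≤ 1 ∧ f 0 = n - 1 - s := ⟨n - 1 - f 0, by omega, by omega⟩
  have hp1 : p ≠ 1 := by
    intro e
    rw [e] at hfp
    exact card_le_three h hn (by omega) hfp hc
  have f1 : f 1 ≠ 0 := fun e => ne 1 (by omega) p hp (by omega) (by omega)
  have n10 := ne 1 (by omega) 0 (by omega) (by omega)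
  left
  by_cases c3 : n - 2 ≤ f 1
  · -- the first two entries are the two largest values
    have n20 := ne 2 (by omega) 0 (by omega) (by omega)
    have n21 := ne 2 (by omega) 1 (by omega) (by omega)
    have b2 : NBad n f 2 := NBad.of_min (fun j hj => by
      have : j = 0 ∨ j = 1 := by omega
      rcases this with rfl | rfl <;> omega)
    have key : ∀ i < n, NBad n f i → i = 0 ∨ i = 1 ∨ i = 2 ∨ i = n - 1 := fun i hi hb =>
      mem_four hc b0 b1 b2 bl hb
        (by omega) (by omega) (by omega) (by omega) hi
        (by omega) (by omega) (by omega) (by omega) (by omega) (by omega)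
    have hp2 : p = 2 := by
      by_contra hne
      have hpl : p = n - 1 := by
        have := key p hp bp
        omega
      have r0 : r ≠ 0 := fun e => by rw [e] at hfr; omega
      have r1 : r ≠ 1 := fun e => by rw [e] at hfr; omega
      have rp : r ≠ p := fun e => by rw [e] at hfr; omega
      have br : NBad n f r := by
        left
        intro j hj hrj
        have := ne j hj 0 (by omega) (by omega)
        have := ne j hj 1 (by omega) (by omega)
        have := h.1 j hj
        omega
      have hr2 : r = 2 := by
        have := key r hr br
        omega
      rw [hr2] at hfr
      have n30 := ne 3 (by omega) 0 (by omega) (by omega)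
      have n31 := ne 3 (by omega) 1 (by omega) (by omega)
      have n32 := ne 3 (by omega) 2 (by omega) (by omega)
      have l3 := h.1 3 (by omega)
      have := key 3 (by omega) (NBad.of_min (fun j hj => by
            have : j = 0 ∨ j = 1 ∨ j = 2 := by omega
            rcases this with rfl | rfl | rfl <;> omega))
      omega
    refine ⟨n - 2, 1, s, hs, Or.inr (Or.inr ⟨rfl, rfl⟩), ?_⟩
    have := eq_famG h hn hp (by omega) hfp hs h0 (by omega) (Or.inr ⟨by omega, hp2⟩) (by omega)
      (fun i hi hm => by have := minp i hi hm; omega)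
    rw [hp2, min_eq_right c3] at this
    exact this
  · -- `y` is the position of the other large value
    obtain ⟨y, hy, hfy⟩ := h.surj (n - 2 + s) (by omega)
    have y0 : y ≠ 0 := fun e => by rw [e] at hfy; omega
    have y1 : y ≠ 1 := fun e => by rw [e] at hfy; omega
    have yp : y ≠ p := fun e => by rw [e] at hfy; omega
    have hby : NBad n f y := by
      by_cases s0 : s = 1
      · exact h.bad_of_gt hy (by omega)
      · left
        intro j hj hyj
        have := ne j hj 0 (by omega) (by omega)
        have := h.1 j hj
        omega
    have key : ∀ i < n, NBad n f i → i = 0 ∨ i = 1 ∨ i = p ∨ i = y := fun i hi hb =>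
      mem_four hc b0 b1 bp hby hb
        (by omega) (by omega) hp hy hi (by omega) (by omega) (by omega) (by omega) (by omega)
        (by omega)
    have hmin : ∀ i < n, (∀ j < i, f i < f j) → i = 0 ∨ i = 1 ∨ i = p := by
      intro i hi hm
      rcases key i hi (NBad.of_min hm) with e | e | e | e
      · exact Or.inl e
      · exact Or.inr (Or.inl e)
      · exact Or.inr (Or.inr e)
      · have := hm 1 (by omega)
        rw [e] at this; omega
    have hlast := key (n - 1) (by omega) bl
    by_cases hpl : p = n - 1
    · have hw : f 1 = 1 := by
        by_contra hw
        obtain ⟨z, hz, hfz⟩ := h.surj 1 (by omega)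
        have zp : z ≠ p := fun e => by rw [e] at hfz; omega
        have := hmin z hz (fun j hj => by
          have := ne j (by omega) z hz (by omega)
          have := ne j (by omega) p hp (by omega)
          omega)
        rcases this with e | e | e
        · rw [e] at hfz; omega
        · rw [e] at hfz; omega
        · exact zp e
      refine ⟨1, n - 2, s, hs, Or.inr (Or.inl ⟨rfl, rfl⟩), ?_⟩
      have := eq_famG h hn hp (by omega) hfp hs h0 (by omega) (Or.inl (by omega)) (by omega) hmin
      rw [hw, hpl, min_eq_left (by omega), show n - 1 - 1 = n - 2 by omega] at this
      exact this
    · have hyl : y = n - 1 := by omega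
      -- before `p`, the values grow from `f 1`
      have above : ∀ i, 1 < i → i < p → f 1 < f i := by
        intro i
        induction i using Nat.strong_induction_on with
        | _ i ih =>
          intro h1i hip
          by_contra hcon
          have n1i := ne 1 (by omega) i (by omega) (by omega)
          have := hmin i (by omega) (fun j hj => by
            by_cases j0 : j = 0
            · rw [j0]; omega
            by_cases j1 : j = 1
            · rw [j1]; omega
            have := ih j hj (by omega) (by omega)
            omega)
          omega
      have grow : ∀ i, i + 1 < p → f 1 + i ≤ f (i + 1) := by
        intro i
        induction i with
        | zero => intro _; simp
        | succ i ih =>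
          intro hip
          have h1 := ih (by omega)
          have h2 := above (i + 1 + 1) (by omega) hip
          have h3 := ne (i + 1) (by omega) (i + 1 + 1) (by omega) (by omega)
          by_contra hcon
          have i0 : i ≠ 0 := by
            rintro rfl
            simp only [zero_add] at *
            omega
          exact h.2.2 1 (i + 1) (i + 1 + 1) (by omega) (by omega) (by omega) h2 (by omega)
      have hgp := grow (p - 2) (by omega)
      rw [show p - 2 + 1 = p - 1 by omega] at hgp
      have q1 := ne (p - 1) (by omega) 0 (by omega) (by omega)
      have q2 := ne (p - 1) (by omega) y hy (by omega)
      have q3 := h.1 (p - 1) (by omega)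
      refine ⟨f 1, p - 1, s, hs, Or.inl ⟨by omega, by omega, by omega⟩, ?_⟩
      have := eq_famG h hn hp (by omega) hfp hs h0 (by omega) (Or.inl (by omega)) (by omega) hmin
      rw [min_eq_left (by omega)] at this
      exact this

/-- A permutation of `Fin n` seen as a function on `ℕ`. -/
def toFun' {n : ℕ} (σ : Equiv.Perm (Fin n)) (i : ℕ) : ℕ :=
  if h : i < n then (σ ⟨i, h⟩ : ℕ) else 0

theorem toFun'_val {n : ℕ} (σ : Equiv.Perm (Fin n)) (i : Fin n) :
    toFun' σ (i : ℕ) = (σ i : ℕ) := by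
  simp [toFun']

theorem toFun'_lt {n : ℕ} (σ : Equiv.Perm (Fin n)) (i : ℕ) (h : i < n) :
    toFun' σ i = (σ ⟨i, h⟩ : ℕ) := by
  simp [toFun', h]

theorem toFun'_good {n : ℕ} (σ : Equiv.Perm (Fin n)) : Avoids132 σ ↔ NGood n (toFun' σ) := by
  constructor
  · intro h
    refine ⟨?_, ?_, ?_⟩
    · intro i hi
      rw [toFun'_lt σ i hi]
      exact (σ ⟨i, hi⟩).2
    · intro i hi j hj e
      rw [toFun'_lt σ i hi, toFun'_lt σ j hj] at e
      have := σ.injective (Fin.ext e)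
      exact congrArg Fin.val this
    · intro i j k hij hjk hk h1 h2
      rw [toFun'_lt σ i (by omega), toFun'_lt σ k hk] at h1
      rw [toFun'_lt σ k hk, toFun'_lt σ j (by omega)] at h2
      exact h ⟨⟨i, by omega⟩, ⟨j, by omega⟩, ⟨k, hk⟩, hij, hjk, h1, h2⟩
  · rintro h ⟨i, j, k, hij, hjk, h1, h2⟩
    refine h.2.2 i j k hij hjk k.2 ?_ ?_
    · rw [toFun'_val, toFun'_val]; exact h1
    · rw [toFun'_val, toFun'_val]; exact h2

theorem one_le_card_filter {n : ℕ} (P : Fin n → Prop) [DecidablePred P] :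
    1 ≤ (Finset.univ.filter P).card ↔ ∃ j, P j := by
  rw [Nat.one_le_iff_ne_zero, ← Nat.pos_iff_ne_zero, Finset.card_pos]
  constructor
  · rintro ⟨j, hj⟩
    exact ⟨j, (Finset.mem_filter.1 hj).2⟩
  · rintro ⟨j, hj⟩
    exact ⟨j, Finset.mem_filter.2 ⟨Finset.mem_univ _, hj⟩⟩

theorem matches_iff {n : ℕ} (σ : Equiv.Perm (Fin n)) (i : Fin n) :
    ¬ MatchesMMP 1 1 1 0 σ i ↔ NBad n (toFun' σ) i := by
  unfold MatchesMMP
  simp only [one_le_card_filter, Nat.zero_le, and_true]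
  constructor
  · intro h
    by_contra hb
    apply h
    unfold NBad at hb
    push Not at hb
    obtain ⟨⟨x, hx, hix, h1⟩, ⟨y, hy, h2⟩, ⟨z, hz, h3⟩⟩ := hb
    have hyn : y < n := lt_trans hy i.2
    have hzn : z < n := lt_trans hz i.2
    rw [toFun'_val, toFun'_lt σ _ hx] at h1
    rw [toFun'_val, toFun'_lt σ _ hyn] at h2
    rw [toFun'_val, toFun'_lt σ _ hzn] at h3
    exact ⟨⟨⟨x, hx⟩, hix, h1⟩, ⟨⟨y, hyn⟩, hy, h2⟩, ⟨⟨z, hzn⟩, hz, h3⟩⟩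
  · rintro hb ⟨⟨x, hx, h1⟩, ⟨y, hy, h2⟩, ⟨z, hz, h3⟩⟩
    refine not_NBad (f := toFun' σ) (x : ℕ) (y : ℕ) (z : ℕ) x.2 hx ?_ hy ?_ hz ?_ hb
    · rw [toFun'_val, toFun'_val]; exact h1
    · rw [toFun'_val, toFun'_val]; exact h2
    · rw [toFun'_val, toFun'_val]; exact h3

open Classical in
theorem mmp_add {n : ℕ} (σ : Equiv.Perm (Fin n)) :
    mmp 1 1 1 0 σ + ((range n).filter (NBad n (toFun' σ))).card = n := by
  have h : ((range n).filter (NBad n (toFun' σ))).card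
      = (Finset.univ.filter (fun i => ¬ MatchesMMP 1 1 1 0 σ i)).card := by
    rw [Finset.card_filter, Finset.sum_range, Finset.card_filter]
    apply Finset.sum_congr rfl
    intro i _
    simp only [matches_iff]
  rw [h]
  unfold mmp
  have := Finset.card_filter_add_card_filter_not (s := (Finset.univ : Finset (Fin n)))
    (fun i => MatchesMMP 1 1 1 0 σ i)
  rw [Finset.card_univ, Fintype.card_fin] at this
  convert this using 2

open Classical in
/-- The permutation with given values. -/
noncomputable def mkPerm (n : ℕ) (f : ℕ → ℕ) : Equiv.Perm (Fin n) :=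
  if h : NGood n f then
    Equiv.ofBijective (fun i : Fin n => (⟨f i, h.1 i i.2⟩ : Fin n))
      (Finite.injective_iff_bijective.1 (fun i j hij =>
        Fin.ext (h.2.1 i i.2 j j.2 (congrArg Fin.val hij))))
  else 1

theorem mkPerm_apply {n : ℕ} {f : ℕ → ℕ} (h : NGood n f) (i : ℕ) (hi : i < n) :
    toFun' (mkPerm n f) i = f i := by
  rw [toFun'_lt _ i hi]
  unfold mkPerm
  rw [dif_pos h]
  rfl

theorem toFun'_ext {n : ℕ} {σ τ : Equiv.Perm (Fin n)}
    (h : ∀ i < n, toFun' σ i = toFun' τ i) : σ = τ := by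
  ext i
  have := h i i.2
  rwa [toFun'_val, toFun'_val] at this

theorem NGood.congr {n : ℕ} {f g : ℕ → ℕ} (hf : NGood n f) (h : ∀ i < n, g i = f i) :
    NGood n g := by
  refine ⟨?_, ?_, ?_⟩
  · intro i hi
    rw [h i hi]; exact hf.1 i hi
  · intro i hi j hj
    rw [h i hi, h j hj]; exact hf.2.1 i hi j hj
  · intro i j k hij hjk hk
    rw [h i (by omega), h j (by omega), h k hk]
    exact hf.2.2 i j k hij hjk hk

theorem NBad.congr {n : ℕ} {f g : ℕ → ℕ} (h : ∀ i < n, g i = f i) (i : ℕ) (hi : i < n)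
    (hb : NBad n f i) : NBad n g i := by
  rcases hb with hb | hb | hb
  · left
    intro j hj hij
    rw [h i hi, h j hj]; exact hb j hj hij
  · right; left
    intro j hj
    rw [h i hi, h j (by omega)]; exact hb j hj
  · right; right
    intro j hj
    rw [h i hi, h j (by omega)]; exact hb j hj

theorem FourBad.congr {n : ℕ} {f g : ℕ → ℕ} {x : ℕ} (hf : FourBad n f x)
    (h : ∀ i < n, g i = f i) : FourBad n g x := by
  refine ⟨hf.1, hf.2.1, ?_⟩
  intro i hi
  rw [← hf.2.2 i hi]
  exact ⟨NBad.congr (fun j hj => (h j hj).symm) i hi, NBad.congr h i hi⟩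

/-- Parameters `(a, k)` of the generic part of the main family. -/
def genParams (n : ℕ) : Finset (ℕ × ℕ) :=
  (range n ×ˢ range n).filter (fun q => 1 ≤ q.1 ∧ 1 ≤ q.2 ∧ q.1 + q.2 ≤ n - 2)

theorem card_genParams (n : ℕ) : (genParams n).card = (n - 2).choose 2 := by
  have h : ((range (n - 2)).sigma (fun j => range j)).card = (genParams n).card := by
    apply Finset.card_bij (fun q _ => (q.2 + 1, q.1 - q.2))
    · rintro ⟨j, i⟩ hq
      simp only [Finset.mem_sigma, Finset.mem_range] at hq
      simp only [genParams, Finset.mem_filter, Finset.mem_product, Finset.mem_range]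
      omega
    · rintro ⟨j, i⟩ hq ⟨j', i'⟩ hq' e
      simp only [Finset.mem_sigma, Finset.mem_range] at hq hq'
      simp only [Prod.mk.injEq] at e
      obtain rfl : j = j' := by omega
      obtain rfl : i = i' := by omega
      rfl
    · rintro ⟨a, k⟩ hq
      simp only [genParams, Finset.mem_filter, Finset.mem_product, Finset.mem_range] at hq
      refine ⟨⟨a + k - 1, a - 1⟩, ?_, ?_⟩
      · simp only [Finset.mem_sigma, Finset.mem_range]
        omega
      · simp only [Prod.mk.injEq]
        omega
  rw [← h, Finset.card_sigma]
  simp only [Finset.card_range]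
  rw [Finset.sum_range_id, Nat.choose_two_right]

/-- All parameters. -/
def allParams (n : ℕ) : Finset ((ℕ × ℕ) × ℕ) :=
  (insert (1, n - 2) (insert (n - 2, 1) (insert (0, 0) (genParams n)))) ×ˢ range 2

theorem card_allParams {n : ℕ} (hn : 5 ≤ n) : (allParams n).card = 6 + 2 * (n - 2).choose 2 := by
  unfold allParams
  rw [Finset.card_product, Finset.card_insert_of_notMem, Finset.card_insert_of_notMem,
    Finset.card_insert_of_notMem, card_genParams, Finset.card_range]
  · ring
  all_goals
    simp only [genParams, Finset.mem_insert, Finset.mem_filter, Finset.mem_product,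
      Finset.mem_range, Prod.mk.injEq]
    omega

/-- The function attached to a parameter. -/
def famAll (n : ℕ) (q : (ℕ × ℕ) × ℕ) : ℕ → ℕ :=
  if q.1.2 = 0 then (if q.2 = 0 then famA n else famB n) else famG n q.1.1 q.1.2 q.2

theorem mem_allParams {n a k s : ℕ} (hn : 5 ≤ n) : ((a, k), s) ∈ allParams n ↔
    s ≤ 1 ∧ ((a = 0 ∧ k = 0) ∨ (1 ≤ a ∧ 1 ≤ k ∧ a + k ≤ n - 2) ∨ (a = 1 ∧ k = n - 2) ∨
      (a = n - 2 ∧ k = 1)) := by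
  simp only [allParams, genParams, Finset.mem_insert, Finset.mem_filter, Finset.mem_product,
      Finset.mem_range, Prod.mk.injEq]
  omega

theorem famAll_good {n : ℕ} (hn : 5 ≤ n) (q : (ℕ × ℕ) × ℕ) (hq : q ∈ allParams n) :
    NGood n (famAll n q) ∧ ∃ x, FourBad n (famAll n q) x := by
  obtain ⟨⟨a, k⟩, s⟩ := q
  rw [mem_allParams hn] at hq
  obtain ⟨hs, h | h | h | h⟩ := hq
  · unfold famAll
    simp only [h.2, if_true]
    split_ifs
    · exact ⟨famA_good hn, _, famA_four hn⟩
    · exact ⟨famB_good hn, _, famB_four hn⟩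
  · have hk : k ≠ 0 := by omega
    simp only [famAll, hk, if_false]
    exact ⟨famG_good hn (by omega) (by omega) (by omega) hs, _,
      famG_four1 hn h.1 h.2.1 h.2.2 hs⟩
  · have hk : k ≠ 0 := by omega
    simp only [famAll, hk, if_false]
    obtain ⟨rfl, rfl⟩ := h
    exact ⟨famG_good hn (by omega) (by omega) (by omega) hs, _, famG_four2 hn hs⟩
  · have hk : k ≠ 0 := by omega
    simp only [famAll, hk, if_false]
    obtain ⟨rfl, rfl⟩ := h
    exact ⟨famG_good hn (by omega) (by omega) (by omega) hs, _, famG_four3 hn hs⟩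

theorem famG_ne_A {n a k s : ℕ} (hn : 5 ≤ n) (hs : s ≤ 1) : famG n a k s 0 ≠ famA n 0 := by
  simp only [famG, famA, if_true]
  omega

theorem famG_ne_B {n a k s : ℕ} (hn : 5 ≤ n) (hs : s ≤ 1) : famG n a k s 0 ≠ famB n 0 := by
  have := famB_spec n 0 hn (by omega)
  simp only [famG, if_true]
  omega

theorem famA_ne_B {n : ℕ} (hn : 5 ≤ n) : famA n 1 ≠ famB n 1 := by
  have := famB_spec n 1 hn (by omega)
  have := famA_spec n 1 hn (by omega)
  omega

theorem famAll_inj {n : ℕ} (hn : 5 ≤ n) (q q' : (ℕ × ℕ) × ℕ) (hq : q ∈ allParams n)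
    (hq' : q' ∈ allParams n) (h : ∀ i < n, famAll n q i = famAll n q' i) : q = q' := by
  obtain ⟨⟨a, k⟩, s⟩ := q
  obtain ⟨⟨a', k'⟩, s'⟩ := q'
  rw [mem_allParams hn] at hq hq'
  have h0 := h 0 (by omega)
  have h1 := h 1 (by omega)
  by_cases hk : k = 0
  · by_cases hk' : k' = 0
    · have ss : s = s' := by
        by_contra hss
        have : (s = 0 ∧ s' ≠ 0) ∨ (s ≠ 0 ∧ s' = 0) := by omega
        rcases this with hh | hh
        · simp only [famAll, hk, hk', hh.1, hh.2, if_true, if_false] at h1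
          exact famA_ne_B hn h1
        · simp only [famAll, hk, hk', hh.1, hh.2, if_true, if_false] at h1
          exact famA_ne_B hn h1.symm
      simp only [Prod.mk.injEq]
      omega
    · exfalso
      simp only [famAll, hk, hk', if_true, if_false] at h0
      split_ifs at h0
      · exact famG_ne_A hn hq'.1 h0.symm
      · exact famG_ne_B hn hq'.1 h0.symm
  · by_cases hk' : k' = 0
    · exfalso
      simp only [famAll, hk, hk', if_true, if_false] at h0
      split_ifs at h0
      · exact famG_ne_A hn hq.1 h0
      · exact famG_ne_B hn hq.1 h0
    · have sp := famG_spec (n := n) (a := a) (k := k) (s := s) hn (by omega) (by omega) (by omega)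
        hq.1
      have sp' := famG_spec (n := n) (a := a') (k := k') (s := s') hn (by omega) (by omega)
        (by omega) hq'.1
      have hk1 := h (k + 1) (by omega)
      simp only [famAll, hk, hk', if_false] at h0 h1 hk1
      have a0 := sp 0 (by omega)
      have a0' := sp' 0 (by omega)
      have a1 := sp 1 (by omega)
      have a1' := sp' 1 (by omega)
      have a2 := sp (k + 1) (by omega)
      have a2' := sp' (k + 1) (by omega)
      have ss : s = s' := by omega
      have kk : k = k' := by
        clear h0 h1 a0 a0' a1 a1' sp sp' h
        rw [hk1] at a2
        omega
      have aa : a = a' := by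
        clear h0 hk1 a0 a0' a2 a2' sp sp' h
        rw [h1] at a1
        omega
      rw [ss, kk, aa]

theorem count_perms (n : ℕ) (hn : 5 ≤ n) :
    (allParams n).card = ((Av132 n).filter (fun σ => n - 4 = mmp 1 1 1 0 σ)).card := by
  classical
  apply Finset.card_bij (fun q _ => mkPerm n (famAll n q))
  · intro q hq
    obtain ⟨hg, x, hx⟩ := famAll_good hn q hq
    have hap := fun i hi => mkPerm_apply hg i hi
    simp only [Av132, Finset.mem_filter, Finset.mem_univ, true_and]
    refine ⟨(toFun'_good _).2 (hg.congr hap), ?_⟩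
    have h1 := (hx.congr hap).card hn
    have h2 := mmp_add (mkPerm n (famAll n q))
    omega
  · intro q hq q' hq' e
    apply famAll_inj hn q q' hq hq'
    intro i hi
    rw [← mkPerm_apply (famAll_good hn q hq).1 i hi, ← mkPerm_apply (famAll_good hn q' hq').1 i hi,
      e]
  · intro σ hσ
    simp only [Av132, Finset.mem_filter, Finset.mem_univ, true_and] at hσ
    have h2 := mmp_add σ
    have hcl := classify ((toFun'_good σ).1 hσ.1) hn (by omega)
    have fin : ∀ q ∈ allParams n, (∀ i < n, toFun' σ i = famAll n q i) →
        ∃ q, ∃ (_ : q ∈ allParams n), mkPerm n (famAll n q) = σ := by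
      intro q hq h
      refine ⟨q, hq, toFun'_ext ?_⟩
      intro i hi
      rw [mkPerm_apply (famAll_good hn q hq).1 i hi, h i hi]
    rcases hcl with ⟨a, k, s, hs, hak, h⟩ | h | h
    · refine fin ((a, k), s) ((mem_allParams hn).2 ⟨hs, Or.inr hak⟩) ?_
      have hk : k ≠ 0 := by omega
      simpa only [famAll, hk, if_false] using h
    · refine fin ((0, 0), 0) ((mem_allParams hn).2 ⟨by omega, Or.inl ⟨rfl, rfl⟩⟩) ?_
      simpa only [famAll, if_true] using h
    · refine fin ((0, 0), 1) ((mem_allParams hn).2 ⟨by omega, Or.inl ⟨rfl, rfl⟩⟩) ?_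
      simpa only [famAll, if_true, one_ne_zero, if_false] using h

/-- for `n ≥ 5`, the coefficient of `x^{n-4}` in
`Q_{n,132}^{(1,1,1,0)}(x)` equals `6 + 2·binom(n-2,2)`. -/
theorem stmt3 (n : ℕ) (hn : 5 ≤ n) :
    (Q n 1 1 1 0).coeff (n - 4) = ((6 + 2 * (n - 2).choose 2 : ℕ) : ℤ) := by
  rw [← card_allParams hn, count_perms n hn]
  unfold Q
  rw [Polynomial.finsetSum_coeff]
  simp only [Polynomial.coeff_X_pow]
  rw [Finset.card_filter]
  push_cast
  rfl
end
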